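/- Fix d ∈ {3,4}, set ℓ = d/(d-2), and let c > 0. Let Q : [0,∞) → (0, 1/d] be the unique function satisfying c·ξ^{2ℓ} = (1 − d·Q(ξ))/Q(ξ)^ℓ for all ξ ≥ 0, and define F(ξ) = d·Q(ξ) + ξ·Q'(ξ) for ξ > 0, with F(0) = 1. Then F solves the nonlocal profile equation: for every ξ > 0, d/dξ[ F(ξ) · ∫₀^ξ F(ζ)·ζ^{d-1} dζ ] = ξ^{d-1}·( (1/2)·ξ·F'(ξ) + F(ξ) ), and moreover ∫₀^ξ F(ζ)·ζ^{d-1} dζ = ξ^d·Q(ξ) for all ξ ≥ 0. -/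

import Mathlib

open Filter Set intervalIntegral

theorem aux_cont (D c : ℝ) (hD : 0 < D) (hD1 : 1 ≤ D) (hc : 0 < c) (n : ℕ) (Q : ℝ → ℝ)
    (h0 : ∀ x, 0 ≤ x → 0 < Q x) (h1 : ∀ x, 0 ≤ x → Q x ≤ 1)
    (h : ∀ x, 0 ≤ x → c * x ^ (2 * n) * Q x ^ n + D * Q x = 1) :
    ContinuousOn Q (Set.Ici 0) := by
  have key : ∀ a, 0 ≤ a → ∀ b, 0 ≤ b → Q b ≤ Q a →
      Q a - Q b ≤ c * |b ^ (2 * n) - a ^ (2 * n)| := by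
    intro a ha b hb hab
    have e1 := h a ha
    have e2 := h b hb
    have p1 : Q b ^ n ≤ Q a ^ n := pow_le_pow_left₀ (h0 b hb).le hab n
    have p2 : Q b ^ n ≤ 1 := pow_le_one₀ (h0 b hb).le (h1 b hb)
    have p3 : 0 < Q b ^ n := pow_pos (h0 b hb) n
    have p4 : 0 ≤ c * a ^ (2 * n) := by positivity
    have p5 := mul_le_mul_of_nonneg_left p1 p4
    have p6 : D * (Q a - Q b) ≤ c * (b ^ (2 * n) - a ^ (2 * n)) * Q b ^ n := by nlinarith
    have p7 : c * (b ^ (2 * n) - a ^ (2 * n)) * Q b ^ n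
        ≤ c * |b ^ (2 * n) - a ^ (2 * n)| * Q b ^ n := by
      gcongr
      exact le_abs_self _
    have p8 : c * |b ^ (2 * n) - a ^ (2 * n)| * Q b ^ n ≤ c * |b ^ (2 * n) - a ^ (2 * n)| :=
      mul_le_of_le_one_right (by positivity) p2
    nlinarith
  intro a ha
  have ha' : 0 ≤ a := ha
  unfold ContinuousWithinAt
  rw [tendsto_iff_dist_tendsto_zero]
  have lim : Tendsto (fun b : ℝ => c * |b ^ (2 * n) - a ^ (2 * n)|) (nhdsWithin a (Set.Ici 0))
      (nhds 0) := by
    have : Continuous (fun b : ℝ => c * |b ^ (2 * n) - a ^ (2 * n)|) := by fun_prop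
    have := (this.tendsto a).mono_left (nhdsWithin_le_nhds (s := Set.Ici 0))
    simpa using this
  refine tendsto_of_tendsto_of_tendsto_of_le_of_le' tendsto_const_nhds lim
    (Eventually.of_forall fun _ => dist_nonneg) ?_
  filter_upwards [self_mem_nhdsWithin] with b hb
  have hb' : 0 ≤ b := hb
  rw [Real.dist_eq]
  rcases le_total (Q b) (Q a) with hab | hab
  · rw [abs_sub_comm, abs_of_nonneg (by linarith)]
    exact key a ha' b hb' hab
  · rw [abs_of_nonneg (by linarith), abs_sub_comm]
    exact key b hb' a ha' hab

theorem aux_deriv (D c : ℝ) (hD : 0 < D) (hD1 : 1 ≤ D) (hc : 0 < c) (n : ℕ) (Q : ℝ → ℝ)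
    (h0 : ∀ x, 0 ≤ x → 0 < Q x) (h1 : ∀ x, 0 ≤ x → Q x ≤ 1)
    (h : ∀ x, 0 ≤ x → c * x ^ (2 * n) * Q x ^ n + D * Q x = 1) (a : ℝ) (ha : 0 < a) :
    DifferentiableAt ℝ Q a := by
  have hcont : ContinuousAt Q a :=
    (aux_cont D c hD hD1 hc n Q h0 h1 h).continuousAt (Ici_mem_nhds ha)
  let T : ℝ → ℝ := fun b => ∑ i ∈ Finset.range (2 * n), b ^ i * a ^ (2 * n - 1 - i)
  let S : ℝ → ℝ := fun b => ∑ i ∈ Finset.range n, Q b ^ i * Q a ^ (n - 1 - i)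
  let φ : ℝ → ℝ := fun b => -(c * Q a ^ n * T b) / (D + c * b ^ (2 * n) * S b)
  have hpos : ∀ b, 0 < b → 0 < D + c * b ^ (2 * n) * S b := by
    intro b hb
    have hS : 0 ≤ S b := Finset.sum_nonneg fun i _ =>
      mul_nonneg (pow_nonneg (h0 b hb.le).le _) (pow_nonneg (h0 a ha.le).le _)
    positivity
  have hT : Continuous T := by fun_prop
  have hS : ContinuousAt S a := by fun_prop
  have hφ : ContinuousAt φ a := by
    apply ContinuousAt.div
    · fun_prop
    · fun_prop
    · exact (hpos a ha).ne'
  have hd : HasDerivAt Q (φ a) a := by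
    rw [hasDerivAt_iff_tendsto_slope]
    refine (hφ.tendsto.mono_left nhdsWithin_le_nhds).congr' ?_
    have hb : ∀ᶠ b in nhdsWithin a {a}ᶜ, 0 < b := nhdsWithin_le_nhds (Ioi_mem_nhds ha)
    filter_upwards [hb, self_mem_nhdsWithin] with b hb hba
    have hne : b - a ≠ 0 := sub_ne_zero.mpr hba
    have t : T b * (b - a) = b ^ (2 * n) - a ^ (2 * n) := geom_sum₂_mul b a (2 * n)
    have s : S b * (Q b - Q a) = Q b ^ n - Q a ^ n := geom_sum₂_mul (Q b) (Q a) n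
    have e1 := h a ha.le
    have e2 := h b hb.le
    rw [slope_def_field, div_eq_div_iff (hpos b hb).ne' hne]
    linear_combination (-c * Q a ^ n) * t - c * b ^ (2 * n) * s + e1 - e2
  exact hd.differentiableAt

theorem aux_val (d n : ℕ) (hd : d = 3 ∨ d = 4) (hn : n = d / (d - 2)) (c : ℝ) (hc : 0 < c)
    (Q : ℝ → ℝ) (h0 : ∀ x, 0 ≤ x → 0 < Q x) (h2 : ∀ x, 0 ≤ x → (d : ℝ) * Q x ≤ 1)
    (h : ∀ x, 0 ≤ x → c * x ^ (2 * n) * Q x ^ n + d * Q x = 1) (a : ℝ) (ha : 0 < a) :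
    HasDerivAt Q (-2 * Q a * (1 - d * Q a) / ((1 - 2 * Q a) * a)) a := by
  have hD1 : (1 : ℝ) ≤ d := by rcases hd with rfl | rfl <;> norm_num
  have hdiff := aux_deriv d c (by linarith) hD1 hc n Q h0
    (fun x hx => by nlinarith [h0 x hx, h2 x hx]) h a ha
  have hQ := hdiff.hasDerivAt
  have hG := ((((hasDerivAt_id a).pow (2 * n)).const_mul c).mul (hQ.pow n)).add
    (hQ.const_mul (d : ℝ))
  have hE := hG.congr_of_eventuallyEq (f₁ := fun _ => (1 : ℝ)) (by
    filter_upwards [Ioi_mem_nhds ha] with b hb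
    exact (h b (le_of_lt hb)).symm)
  have e := hE.unique (hasDerivAt_const a (1 : ℝ))
  have q0 := h0 a ha.le
  have q2 := h2 a ha.le
  have q := h a ha.le
  have hz : 0 < 1 - 2 * Q a := by rcases hd with rfl | rfl <;> norm_num at q2 <;> linarith
  suffices hh : -2 * Q a * (1 - d * Q a) / ((1 - 2 * Q a) * a) = deriv Q a by
    rw [hh]
    exact hQ
  simp only [Pi.pow_apply, id] at e
  clear hE hG hQ hdiff h h0 h2
  rw [div_eq_iff (by positivity)]
  generalize deriv Q a = z at e
  generalize Q a = y at *
  rcases hd with rfl | rfl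
  · obtain rfl : n = 3 := by simpa using hn
    simp at e q ⊢
    linear_combination (-(a * y / 3)) * e + (2 * y + a * z) * q
  · obtain rfl : n = 2 := by simpa using hn
    simp at e q ⊢
    linear_combination (-(a * y / 2)) * e + (2 * y + a * z) * q

/-- The intermediate profile `F(ξ) = dQ(ξ) + ξQ'(ξ)` solves the nonlocal profile equation
`d/dξ[ F(ξ) ∫₀^ξ F(ζ) ζ^{d-1} dζ ] = ξ^{d-1}((ξ/2)F'(ξ) + F(ξ))`, and its partial mass
satisfies `∫₀^ξ F(ζ) ζ^{d-1} dζ = ξ^d Q(ξ)`. -/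
theorem profile_F_solves_nonlocal_equation
    (d : ℕ) (hd : d = 3 ∨ d = 4)
    (ℓ : ℕ) (hℓ : ℓ = d / (d - 2))
    (c : ℝ) (hc : 0 < c)
    (Q : ℝ → ℝ)
    (hQ : ∀ ξ : ℝ, 0 ≤ ξ → Q ξ ∈ Set.Ioc 0 (1 / (d : ℝ)) ∧
      c * ξ ^ (2 * ℓ) = (1 - (d : ℝ) * Q ξ) / Q ξ ^ ℓ)
    (F : ℝ → ℝ)
    (hF0 : F 0 = 1)
    (hF : ∀ ξ : ℝ, 0 < ξ → F ξ = (d : ℝ) * Q ξ + ξ * deriv Q ξ) :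
    (∀ ξ : ℝ, 0 < ξ →
      deriv (fun w => F w * ∫ ζ in (0 : ℝ)..w, F ζ * ζ ^ (d - 1)) ξ
        = ξ ^ (d - 1) * (1 / 2 * ξ * deriv F ξ + F ξ)) ∧
    (∀ ξ : ℝ, 0 ≤ ξ → (∫ ζ in (0 : ℝ)..ξ, F ζ * ζ ^ (d - 1)) = ξ ^ d * Q ξ) := by
  have h0 : ∀ x, 0 ≤ x → 0 < Q x := fun x hx => (hQ x hx).1.1
  have hdp : (0 : ℝ) < d := by rcases hd with rfl | rfl <;> norm_num
  have h2 : ∀ x, 0 ≤ x → (d : ℝ) * Q x ≤ 1 := fun x hx => by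
    have := (hQ x hx).1.2
    rw [le_div_iff₀ hdp] at this
    linarith
  have h : ∀ x, 0 ≤ x → c * x ^ (2 * ℓ) * Q x ^ ℓ + d * Q x = 1 := fun x hx => by
    rw [(hQ x hx).2, div_mul_cancel₀ _ (pow_pos (h0 x hx) ℓ).ne']
    ring
  have hD1 : (1 : ℝ) ≤ d := by rcases hd with rfl | rfl <;> norm_num
  have hz : ∀ x, 0 ≤ x → 0 < 1 - 2 * Q x := fun x hx => by
    have q2 := h2 x hx
    rcases hd with rfl | rfl <;> norm_num at q2 <;> linarith [h0 x hx]
  have hcont := aux_cont d c hdp hD1 hc ℓ Q h0 (fun x hx => by nlinarith [h0 x hx, h2 x hx]) h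
  have hder := aux_val d ℓ hd hℓ c hc Q h0 h2 h
  have hFv : ∀ x, 0 ≤ x → F x = (d - 2) * Q x / (1 - 2 * Q x) := by
    intro x hx
    have hzx := (hz x hx).ne'
    rcases hx.eq_or_lt with rfl | hx
    · have := h 0 le_rfl
      have hl : ℓ ≠ 0 := by rcases hd with rfl | rfl <;> simp [hℓ]
      simp [hl] at this
      rw [hF0, eq_div_iff hzx]
      linarith
    · rw [hF x hx, (hder x hx).deriv, eq_div_iff hzx]
      have := hx.ne'
      have e : x * (-2 * Q x * (1 - d * Q x) / ((1 - 2 * Q x) * x)) * (1 - 2 * Q x)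
          = -2 * Q x * (1 - d * Q x) := by
        generalize 1 - 2 * Q x = w at *
        field_simp
      rw [add_mul, e]
      ring
  have hFc : ContinuousOn F (Set.Ici 0) := by
    have : ContinuousOn (fun x => ((d : ℝ) - 2) * Q x / (1 - 2 * Q x)) (Set.Ici 0) :=
      ContinuousOn.div (by fun_prop) (by fun_prop) (fun x hx => (hz x hx).ne')
    exact this.congr fun x hx => hFv x hx
  have hint : ∀ ξ : ℝ, 0 ≤ ξ → (∫ ζ in (0 : ℝ)..ξ, F ζ * ζ ^ (d - 1)) = ξ ^ d * Q ξ := by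
    intro ξ hξ
    have hs : Set.Icc 0 ξ ⊆ Set.Ici 0 := fun x hx => hx.1
    have hc1 : ContinuousOn Q (Set.Icc 0 ξ) := hcont.mono hs
    have hc2 : ContinuousOn F (Set.Icc 0 ξ) := hFc.mono hs
    have := integral_eq_sub_of_hasDerivAt_of_le (f := fun x => x ^ d * Q x)
      (f' := fun x => F x * x ^ (d - 1)) hξ (by fun_prop) (by
        intro x hx
        refine (((hasDerivAt_id x).pow d).mul (hder x hx.1)).congr_deriv ?_
        rw [hF x hx.1, (hder x hx.1).deriv]
        obtain ⟨m, rfl⟩ : ∃ m, d = m + 1 := ⟨d - 1, by omega⟩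
        simp only [Pi.pow_apply, id, Nat.add_sub_cancel, pow_succ]
        ring) (by
        apply ContinuousOn.intervalIntegrable
        rw [Set.uIcc_of_le hξ]
        fun_prop)
    rw [this]
    have : d ≠ 0 := by omega
    simp [this]
  refine ⟨?_, hint⟩
  intro ξ hξ
  have hzx := (hz ξ hξ.le).ne'
  have hq := hder ξ hξ
  have hFd : HasDerivAt F _ ξ :=
    ((hq.const_mul ((d : ℝ) - 2)).div ((hq.const_mul 2).const_sub 1) hzx).congr_of_eventuallyEq (by
      filter_upwards [Ioi_mem_nhds hξ] with b hb
      exact hFv b (le_of_lt hb))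
  have hprod := (hFd.mul (((hasDerivAt_id ξ).pow d).mul hq)).congr_of_eventuallyEq
    (f₁ := fun w => F w * ∫ ζ in (0 : ℝ)..w, F ζ * ζ ^ (d - 1)) (by
      filter_upwards [Ioi_mem_nhds hξ] with b hb
      simp [hint b (le_of_lt hb)])
  rw [hprod.deriv, hFd.deriv, hFv ξ hξ.le]
  obtain ⟨m, rfl⟩ : ∃ m, d = m + 1 := ⟨d - 1, by omega⟩
  simp
  have := hξ.ne'
  field_simp
  ring
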